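/- Let I and J be independent sets of a tree T such that I ↭ J. Then every TS-sequence S between I and J satisfies len(S) ≥ M*(T,I,J) + D*(T,I,J). -/

import Mathlib

/-!
Common definitions for formalizing "Shortest Reconfiguration Sequence for
Sliding Tokens on Spiders" (Hoang, Khorramian, Uehara).
-/

namespace SlidingTokenPaper

variable {V : Type*} [Fintype V] [DecidableEq V]

/-- A finite vertex set is independent in `G`. -/
def IsIndep (G : SimpleGraph V) (I : Finset V) : Prop :=
  ∀ x ∈ I, ∀ y ∈ I, ¬ G.Adj x y

/-- One token slide: a token moves from `x` to `y` along an edge `xy`. -/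
def Step (G : SimpleGraph V) (A B : Finset V) : Prop :=
  ∃ x y : V, G.Adj x y ∧ A \ B = {x} ∧ B \ A = {y}

/-- `S` is a TS-sequence between the independent sets `I` and `J` of `G`. -/
def IsTSSeq (G : SimpleGraph V) (I J : Finset V) (S : List (Finset V)) : Prop :=
  S ≠ [] ∧ S.head? = some I ∧ S.getLast? = some J ∧
  (∀ A ∈ S, IsIndep G A ∧ A.card = I.card) ∧ List.Chain' (Step G) S

/-- The length of a TS-sequence: number of token slides. -/
def len (S : List (Finset V)) : ℕ := S.length - 1

/-- `I ↭ J`: there is a TS-sequence between `I` and `J`. -/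
def Reconf (G : SimpleGraph V) (I J : Finset V) : Prop :=
  ∃ S, IsTSSeq G I J S

/-- `M*(G,I,J)`: the minimum over all bijections (target assignments)
`f : I → J` of `∑_{w ∈ I} dist_G(w, f(w))`. -/
noncomputable def Mstar (G : SimpleGraph V) (I J : Finset V) : ℕ :=
  sInf { m : ℕ | ∃ e : {x // x ∈ I} ≃ {y // y ∈ J},
    m = ∑ x : {x // x ∈ I}, G.dist (x : V) ((e x : V)) }

/-- The number of occurrences of the move `x → y` in `S`. -/
def moveCount (S : List (Finset V)) (x y : V) : ℕ :=
  ((S.zip S.tail).filter fun p => p.1 \ p.2 = {x} ∧ p.2 \ p.1 = {y}).length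

/-- `D_G(S, e)`: twice the minimum of the numbers of occurrences of the moves
`x → y` and `y → x` in `S`, where `e = xy`. -/
def detours (S : List (Finset V)) : Sym2 V → ℕ :=
  Sym2.lift ⟨fun x y => 2 * min (moveCount S x y) (moveCount S y x),
    fun x y => by dsimp only; rw [min_comm]⟩

open scoped Classical in
/-- `D_G(S)`: the total number of detours `S` makes, summed over the edges. -/
noncomputable def totalDetours (G : SimpleGraph V) (S : List (Finset V)) : ℕ :=
  ∑ e ∈ Finset.univ.filter (· ∈ G.edgeSet), detours S e

/-- `D*(G,I,J)`: the minimum number of detours of a TS-sequence between `I` and `J`. -/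
noncomputable def Dstar (G : SimpleGraph V) (I J : Finset V) : ℕ :=
  sInf { d : ℕ | ∃ S, IsTSSeq G I J S ∧ d = totalDetours G S }

/-- The token on `u ∈ I` is `(G, I)`-rigid: `u` belongs to every independent set
reachable from `I`. -/
def RigidToken (G : SimpleGraph V) (I : Finset V) (u : V) : Prop :=
  ∀ I', Reconf G I I' → u ∈ I'

/-- `G` is a spider with body `v`: a tree with exactly one vertex of degree ≥ 3. -/
def IsSpider (G : SimpleGraph V) (v : V) : Prop :=
  G.IsTree ∧ 3 ≤ (G.neighborSet v).ncard ∧ ∀ w, 3 ≤ (G.neighborSet w).ncard → w = v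

/-- For adjacent `x, y` in a tree `T`, `side T x y` is the vertex set of `T^x_y`,
the component of `T − xy` containing `y` (vertices strictly closer to `y` than to `x`). -/
def side (G : SimpleGraph V) (x y : V) : Set V :=
  {z | G.dist z y < G.dist z x}

/-- `|I ∩ V(L)|` for the leg `L` of the spider with body `v` containing the
neighbor `w` of `v`. -/
noncomputable def legCard (G : SimpleGraph V) (I : Finset V) (v w : V) : ℕ :=
  ((I : Set V) ∩ side G v w).ncard

/-- `|I ∩ V(L)| − |J ∩ V(L)|` for the leg `L` of the spider indexed by the
neighbor `w` of the body `v`. -/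
noncomputable def legDiff (G : SimpleGraph V) (I J : Finset V) (v w : V) : ℤ :=
  (legCard G I v w : ℤ) - (legCard G J v w : ℤ)

/-- The leg indexed by the neighbor `w₁` of `v` may serve as `L_1` in a labeling
of the legs making `|I∩V(L_i)| − |J∩V(L_i)|` nondecreasing, i.e. it minimizes the
difference. -/
def IsFirstLeg (G : SimpleGraph V) (I J : Finset V) (v w₁ : V) : Prop :=
  G.Adj v w₁ ∧ ∀ w, G.Adj v w → legDiff G I J v w₁ ≤ legDiff G I J v w

/-- `I_L` for the leg `L` indexed by the neighbor `w` of the body `v`, where the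
first leg (indexed by `w₁`) additionally receives `I ∩ {v}`. -/
noncomputable def ILeg (G : SimpleGraph V) (I : Finset V) (v w₁ w : V) : Set V :=
  ((I : Set V) ∩ side G v w) ∪ (if w = w₁ then (I : Set V) ∩ {v} else ∅)

/-- `|I_L|` for the leg `L` indexed by the neighbor `w` of the body `v`. -/
noncomputable def ILegCard (G : SimpleGraph V) (I : Finset V) (v w₁ w : V) : ℕ :=
  (ILeg G I v w₁ w).ncard

/-- `S` makes a detour over the edge `ab`: both moves `a → b` and `b → a` occur in `S`. -/
def MakesDetour (S : List (Finset V)) (a b : V) : Prop :=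
  0 < moveCount S a b ∧ 0 < moveCount S b a


/-- Prepending a configuration to a sequence adds the first move to the move counts. -/
lemma moveCount_cons_cons {V : Type*} [DecidableEq V] (A B : Finset V)
    (l : List (Finset V)) (x y : V) :
    moveCount (A :: B :: l) x y =
      (if A \ B = {x} ∧ B \ A = {y} then 1 else 0) + moveCount (B :: l) x y := by
  by_cases h : A \ B = {x} ∧ B \ A = {y}
  · simp [moveCount, h, add_comm]
  · simp [moveCount, h]

/-- For a slide from `a` to `b`, the first-move indicator is the indicator of `(a, b)`. -/
lemma sdiff_eq_singleton_iff_of_step {V : Type*} [DecidableEq V] {A B : Finset V} {a b : V}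
    (h₁ : A \ B = {a}) (h₂ : B \ A = {b}) (x y : V) :
    (A \ B = {x} ∧ B \ A = {y}) ↔ a = x ∧ b = y := by
  simp [h₁, h₂]

lemma adj_of_moveCount_pos {V : Type*} [DecidableEq V] {G : SimpleGraph V}
    {l : List (Finset V)} (hl : l.IsChain (Step G)) {x y : V} (h : 0 < moveCount l x y) :
    G.Adj x y := by
  induction l with
  | nil => simp [moveCount] at h
  | cons A l ih =>
    cases l with
    | nil => simp [moveCount] at h
    | cons B l =>
      rw [List.isChain_cons_cons] at hl
      obtain ⟨⟨a, b, hab, h₁, h₂⟩, hl⟩ := hl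
      rw [moveCount_cons_cons, if_congr (sdiff_eq_singleton_iff_of_step h₁ h₂ x y) rfl rfl] at h
      split_ifs at h with hxy
      · rwa [← hxy.1, ← hxy.2]
      · exact ih hl (by simpa using h)

/-- The moves of a sequence are exactly accounted for by the move counts. -/
lemma sum_moveCount {V : Type*} [Fintype V] [DecidableEq V] {G : SimpleGraph V}
    {l : List (Finset V)} (hl : l.IsChain (Step G)) :
    ∑ x, ∑ y, moveCount l x y = len l := by
  induction l with
  | nil => simp [moveCount, len]
  | cons A l ih =>
    cases l with
    | nil => simp [moveCount, len]
    | cons B l =>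
      rw [List.isChain_cons_cons] at hl
      obtain ⟨⟨a, b, hab, h₁, h₂⟩, hl⟩ := hl
      have ih := ih hl
      simp only [moveCount_cons_cons, sdiff_eq_singleton_iff_of_step h₁ h₂,
        Finset.sum_add_distrib, ih]
      simp [len, ite_and, add_comm]

/-- Conservation of tokens: the net flow out of `v` is the change of occupation of `v`. -/
lemma sum_moveCount_sub {V : Type*} [Fintype V] [DecidableEq V] {G : SimpleGraph V}
    {l : List (Finset V)} (hl : l.IsChain (Step G)) {I J : Finset V}
    (hI : l.head? = some I) (hJ : l.getLast? = some J) (v : V) :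
    ∑ w, ((moveCount l v w : ℤ) - moveCount l w v) =
      (if v ∈ I then 1 else 0) - (if v ∈ J then 1 else 0) := by
  induction l generalizing I with
  | nil => simp at hI
  | cons A l ih =>
    obtain rfl : A = I := by simpa using hI
    cases l with
    | nil =>
      obtain rfl : A = J := by simpa using hJ
      simp [moveCount]
    | cons B l =>
      rw [List.isChain_cons_cons] at hl
      obtain ⟨⟨a, b, hab, h₁, h₂⟩, hl⟩ := hl
      have ih := ih hl (I := B) rfl (by simpa using hJ)
      have hstep : (if v ∈ A then (1 : ℤ) else 0) - (if v ∈ B then 1 else 0) =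
          (if a = v then 1 else 0) - (if b = v then 1 else 0) := by
        have e₁ := Finset.ext_iff.mp h₁ v
        have e₂ := Finset.ext_iff.mp h₂ v
        simp only [Finset.mem_sdiff, Finset.mem_singleton] at e₁ e₂
        grind
      simp only [moveCount_cons_cons, sdiff_eq_singleton_iff_of_step h₁ h₂]
      simp only [Finset.sum_sub_distrib, Nat.cast_add, Finset.sum_add_distrib] at ih ⊢
      have t₁ : ∑ w, (((if a = v ∧ b = w then 1 else 0 : ℕ) : ℕ) : ℤ) =
          if a = v then 1 else 0 := by simp [ite_and]
      have t₂ : ∑ w, (((if a = w ∧ b = v then 1 else 0 : ℕ) : ℕ) : ℤ) =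
          if b = v then 1 else 0 := by simp [ite_and]
      rw [t₁, t₂]
      linarith

/-- The detours of a sequence are bounded by the sum over ordered pairs of the smaller of
the two opposite move counts. -/
lemma totalDetours_le {V : Type*} [Fintype V] [DecidableEq V] (G : SimpleGraph V)
    (S : List (Finset V)) :
    totalDetours G S ≤ ∑ x, ∑ y, min (moveCount S x y) (moveCount S y x) := by
  classical
  rw [← Fintype.sum_prod_type' (f := fun x y => min (moveCount S x y) (moveCount S y x)),
    ← Finset.sum_fiberwise Finset.univ (fun p : V × V => s(p.1, p.2)), totalDetours]
  refine (Finset.sum_le_sum fun e he => ?_).trans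
    (Finset.sum_le_sum_of_subset (Finset.filter_subset _ _))
  induction e with | _ a b =>
  have hab : a ≠ b := G.ne_of_adj (by simpa using he)
  have hfiber : (Finset.univ.filter fun p : V × V => s(p.1, p.2) = s(a, b)) =
      {(a, b), (b, a)} := by
    ext ⟨x, y⟩
    simp
  rw [hfiber, Finset.sum_pair (by simp [hab])]
  simp only [detours, Sym2.lift_mk]
  rw [min_comm (moveCount S b a), two_mul]

/-- Two families with fibers of equal sizes agree up to reindexing. -/
lemma exists_equiv_of_card_fiber_eq {ι κ V : Type*} [Fintype ι] [Fintype κ] [DecidableEq V]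
    (p : ι → V) (q : κ → V)
    (h : ∀ v, Fintype.card {i // p i = v} = Fintype.card {k // q k = v}) :
    ∃ e : ι ≃ κ, ∀ i, q (e i) = p i := by
  refine ⟨(Equiv.sigmaFiberEquiv p).symm.trans
    ((Equiv.sigmaCongrRight fun v => Fintype.equivOfCardEq (h v)).trans
      (Equiv.sigmaFiberEquiv q)), fun i => ?_⟩
  exact (Fintype.equivOfCardEq (h (p i)) ⟨i, rfl⟩).2

/-- An integral flow carrying the configuration `p` to the configuration `q` costs at least as
much as some matching of `p` with `q`. -/
lemma exists_equiv_sum_dist_le_of_flow {V ι κ : Type*} [Fintype V] [DecidableEq V]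
    [Fintype ι] [Fintype κ] {G : SimpleGraph V} (hG : G.Connected)
    (hcard : Fintype.card ι = Fintype.card κ) (q : κ → V) (n : ℕ) (p : ι → V) (f : V → V → ℕ)
    (hf : ∀ x y, 0 < f x y → G.Adj x y) (hn : ∑ x, ∑ y, f x y = n)
    (hbal : ∀ v, ∑ w, ((f v w : ℤ) - f w v) =
      (∑ i, if p i = v then 1 else 0) - ∑ k, if q k = v then 1 else 0) :
    ∃ e : ι ≃ κ, ∑ i, G.dist (p i) (q (e i)) ≤ n := by
  classical
  induction n generalizing p f with
  | zero =>
    have hzero : ∀ x y, f x y = 0 := by simpa using hn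
    obtain ⟨e, he⟩ := exists_equiv_of_card_fiber_eq p q fun v => by
      have := hbal v
      simp only [hzero] at this
      simp only [Fintype.card_subtype, Finset.card_filter]
      zify
      simp at this ⊢
      linarith
    exact ⟨e, by simp [he]⟩
  | succ n ih =>
    by_cases heq : ∀ v, Fintype.card {i // p i = v} = Fintype.card {k // q k = v}
    · obtain ⟨e, he⟩ := exists_equiv_of_card_fiber_eq p q heq
      exact ⟨e, by simp [he]⟩
    · obtain ⟨u, hu⟩ : ∃ u, Fintype.card {k // q k = u} < Fintype.card {i // p i = u} := by
        by_contra! hle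
        apply heq
        have hsum : ∑ v, Fintype.card {i // p i = v} = ∑ v, Fintype.card {k // q k = v} := by
          rw [← Fintype.card_sigma, ← Fintype.card_sigma,
            Fintype.card_congr (Equiv.sigmaFiberEquiv p),
            Fintype.card_congr (Equiv.sigmaFiberEquiv q), hcard]
        exact fun v => (Finset.sum_eq_sum_iff_of_le fun v _ => hle v).mp hsum v (Finset.mem_univ v)
      obtain ⟨⟨i, hi⟩⟩ : Nonempty {i // p i = u} :=
        Fintype.card_pos_iff.mp (by omega)
      obtain ⟨w, hw⟩ : ∃ w, 0 < f u w := by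
        by_contra! hle
        have := hbal u
        simp only [Fintype.card_subtype, Finset.card_filter] at hu
        zify at hu
        have hnonpos : ∑ w, ((f u w : ℤ) - f w u) ≤ 0 :=
          Finset.sum_nonpos fun w _ => by have := hle w; omega
        linarith
      have hdist : G.dist u w = 1 := SimpleGraph.dist_eq_one_iff_adj.mpr (hf u w hw)
      set g : V → V → ℕ := fun x y => if u = x ∧ w = y then f x y - 1 else f x y with hg
      have hfg : ∀ x y, f x y = g x y + if u = x ∧ w = y then 1 else 0 := by
        intro x y
        simp only [hg]
        split_ifs with h
        · obtain ⟨rfl, rfl⟩ := h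
          omega
        · rfl
      have hp : ∀ v, (∑ j, if Function.update p i w j = v then (1 : ℤ) else 0) +
          (if u = v then 1 else 0) = (∑ j, if p j = v then (1 : ℤ) else 0) +
          (if w = v then 1 else 0) := by
        intro v
        rw [← Finset.add_sum_erase _ _ (Finset.mem_univ i),
          ← Finset.add_sum_erase (a := i) _ (fun j => if p j = v then (1 : ℤ) else 0)
            (Finset.mem_univ i),
          Finset.sum_congr rfl fun j hj => by
            rw [Function.update_of_ne (Finset.ne_of_mem_erase hj)]]
        simp only [Function.update_self, hi]
        ring
      obtain ⟨e, he⟩ := ih (Function.update p i w) g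
        (fun x y h => hf x y (by rw [hfg]; omega))
        (by
          simp only [hfg, Finset.sum_add_distrib] at hn
          simpa [ite_and] using hn)
        (fun v => by
          have h₁ := hbal v
          have h₂ := hp v
          simp only [hfg, Nat.cast_add, Finset.sum_sub_distrib, Finset.sum_add_distrib] at h₁ ⊢
          have t₁ : ∑ y, (((if u = v ∧ w = y then 1 else 0 : ℕ) : ℕ) : ℤ) =
              if u = v then 1 else 0 := by simp [ite_and]
          have t₂ : ∑ y, (((if u = y ∧ w = v then 1 else 0 : ℕ) : ℕ) : ℤ) =
              if w = v then 1 else 0 := by simp [ite_and]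
          rw [t₁, t₂] at h₁
          linarith)
      refine ⟨e, ?_⟩
      rw [← Finset.add_sum_erase _ _ (Finset.mem_univ i)] at he ⊢
      rw [Finset.sum_congr rfl fun j hj => by
        rw [Function.update_of_ne (Finset.ne_of_mem_erase hj)]] at he
      have htri := hG.dist_triangle (u := u) (v := w) (w := q (e i))
      simp only [Function.update_self] at he
      rw [hi]
      omega

/-- Lemma 2 of the paper. For independent sets `I`, `J` of a
tree `T` with `I ↭ J`, every TS-sequence `S` between `I` and `J` satisfies
`len(S) ≥ M*(T,I,J) + D*(T,I,J)`. -/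
theorem tree_TS_sequence_lower_bound
    {V : Type*} [Fintype V] [DecidableEq V] (T : SimpleGraph V) (hT : T.IsTree)
    (I J : Finset V) (hI : IsIndep T I) (hJ : IsIndep T J)
    (hreconf : Reconf T I J)
    (S : List (Finset V)) (hS : IsTSSeq T I J S) :
    Mstar T I J + Dstar T I J ≤ len S := by
  classical
  obtain ⟨hne, hhead, hlast, hmem, hchain⟩ := hS
  have hcard : Fintype.card {x // x ∈ I} = Fintype.card {y // y ∈ J} := by
    simpa using (hmem J (List.mem_of_getLast? hlast)).2.symm
  have hocc : ∀ (A : Finset V) (v : V),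
      (∑ i : {x // x ∈ A}, if (i : V) = v then (1 : ℤ) else 0) = if v ∈ A then 1 else 0 := by
    intro A v
    rw [Finset.sum_coe_sort A (fun x => if x = v then (1 : ℤ) else 0)]
    simp
  obtain ⟨e, he⟩ := exists_equiv_sum_dist_le_of_flow hT.connected hcard (fun y => (y : V)) _
    (fun x => (x : V)) (fun x y => moveCount S x y - moveCount S y x)
    (fun x y h => adj_of_moveCount_pos hchain (by omega)) rfl
    (fun v => by
      rw [hocc, hocc, ← sum_moveCount_sub hchain hhead hlast v]
      exact Finset.sum_congr rfl fun w _ => by omega)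
  have hM : Mstar T I J ≤ ∑ x, ∑ y, (moveCount S x y - moveCount S y x) :=
    le_trans (Nat.sInf_le (by exact ⟨e, rfl⟩)) he
  have hD : Dstar T I J ≤ totalDetours T S :=
    Nat.sInf_le (by exact ⟨S, ⟨hne, hhead, hlast, hmem, hchain⟩, rfl⟩)
  calc Mstar T I J + Dstar T I J
      ≤ ∑ x, ∑ y, (moveCount S x y - moveCount S y x) +
          ∑ x, ∑ y, min (moveCount S x y) (moveCount S y x) :=
        add_le_add hM (hD.trans (totalDetours_le T S))
    _ = ∑ x, ∑ y, moveCount S x y := by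
        simp only [← Finset.sum_add_distrib]
        exact Finset.sum_congr rfl fun x _ => Finset.sum_congr rfl fun y _ => by omega
    _ = len S := sum_moveCount hchain

end SlidingTokenPaper
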